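/- In a group G generated by involutions t_1, ..., t_{n−1} satisfying t_i t_j = t_j t_i for |i − j| > 1 and (t_i q_{j,k})² = 1 for all i+1 < j < k ≤ n (where q_i = t_1(t_2 t_1)⋯(t_i⋯t_1) and q_{j,k} = q_{k−1} q_{k−j} q_{k−1}), the following cactus relations hold: q_{i,j}² = 1; q_{i,j} q_{k,l} q_{i,j} = q_{i+j−l, i+j−k} for i ≤ k < l ≤ j; and q_{i,j} q_{k,l} = q_{k,l} q_{i,j} for j < k. -/

import Mathlib

/-- The descending word `d_i = t_i t_{i-1} ⋯ t_1` (with `d_0 = 1`). -/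
def dword {G : Type*} [Group G] (t : ℕ → G) : ℕ → G
  | 0 => 1
  | (i + 1) => t (i + 1) * dword t i

/-- The element `q_i = t_1 (t_2 t_1) ⋯ (t_i t_{i-1} ⋯ t_1)` (with `q_0 = 1`). -/
def qword {G : Type*} [Group G] (t : ℕ → G) : ℕ → G
  | 0 => 1
  | (i + 1) => qword t i * dword t (i + 1)

/-- The element `q_{i,j} := q_{j-1} q_{j-i} q_{j-1}`. -/
def qq {G : Type*} [Group G] (q : ℕ → G) (i j : ℕ) : G :=
  q (j - 1) * q (j - i) * q (j - 1)

theorem aux_d {G : Type*} [Group G] (t : ℕ → G) (x : G) (m : ℕ)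
    (h : ∀ i, 1 ≤ i → i ≤ m → Commute (t i) x) : Commute (dword t m) x := by
  induction m with
  | zero => exact Commute.one_left x
  | succ m ih =>
    exact (h (m+1) (by omega) le_rfl).mul_left (ih fun i h1 h2 => h i h1 (by omega))

theorem aux_q {G : Type*} [Group G] (t : ℕ → G) (x : G) (m : ℕ)
    (h : ∀ i, 1 ≤ i → i ≤ m → Commute (t i) x) : Commute (qword t m) x := by
  induction m with
  | zero => exact Commute.one_left x
  | succ m ih =>
    exact (ih fun i h1 h2 => h i h1 (by omega)).mul_left (aux_d t x (m+1) h)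

theorem aux_qq {G : Type*} [Group G] (t : ℕ → G) (x : G) (a b : ℕ) (ha : 1 ≤ a)
    (h : ∀ i, 1 ≤ i → i ≤ b - 1 → Commute (t i) x) : Commute (qq (qword t) a b) x := by
  have h1 := aux_q t x (b-1) h
  have h2 := aux_q t x (b-a) fun i h1 h2 => h i h1 (by omega)
  exact (h1.mul_left h2).mul_left h1

section
variable {G : Type*} [Group G] (N : ℕ) (t : ℕ → G)

theorem aux_dq (hinv : ∀ i, 1 ≤ i → i ≤ N → t i * t i = 1)
    (hcomm : ∀ i j, 1 ≤ i → i ≤ N → 1 ≤ j → j ≤ N → (i + 1 < j ∨ j + 1 < i) →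
      t i * t j = t j * t i) (m : ℕ) (hm : m + 1 ≤ N) :
    dword t (m+1) * qword t (m+1) = qword t m := by
  induction m with
  | zero => simpa [dword, qword] using hinv 1 le_rfl hm
  | succ m ih =>
    have ih := ih (by omega)
    have hc : Commute (qword t m) (t (m+2)) := aux_q t _ m fun i h1 h2 =>
      hcomm i (m+2) h1 (by omega) (by omega) (by omega) (by omega)
    have e1 : dword t (m+1+1) = t (m+2) * dword t (m+1) := rfl
    have e2 : qword t (m+1+1) = qword t (m+1) * dword t (m+1+1) := rfl
    have e3 : qword t (m+1) = qword t m * dword t (m+1) := rfl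
    calc dword t (m+1+1) * qword t (m+1+1)
        = t (m+2) * (dword t (m+1) * qword t (m+1)) * (t (m+2) * dword t (m+1)) := by
          rw [e2, e1]; simp only [mul_assoc]
      _ = t (m+2) * (qword t m * t (m+2)) * dword t (m+1) := by
          rw [ih]; simp only [mul_assoc]
      _ = (t (m+2) * t (m+2)) * (qword t m * dword t (m+1)) := by
          rw [hc.eq]; simp only [mul_assoc]
      _ = _ := by rw [hinv (m+2) (by omega) (by omega), one_mul, e3]

theorem aux_sq (hinv : ∀ i, 1 ≤ i → i ≤ N → t i * t i = 1)
    (hcomm : ∀ i j, 1 ≤ i → i ≤ N → 1 ≤ j → j ≤ N → (i + 1 < j ∨ j + 1 < i) →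
      t i * t j = t j * t i) (m : ℕ) (hm : m ≤ N) : qword t m * qword t m = 1 := by
  induction m with
  | zero => simp [qword]
  | succ m ih =>
    have h := aux_dq N t hinv hcomm m hm
    have ih := ih (by omega)
    have e2 : qword t (m+1) = qword t m * dword t (m+1) := rfl
    calc qword t (m+1) * qword t (m+1)
        = qword t m * (dword t (m+1) * qword t (m+1)) := by
          rw [← mul_assoc, ← e2]
      _ = 1 := by rw [h, ih]

theorem aux_qqsq (hinv : ∀ i, 1 ≤ i → i ≤ N → t i * t i = 1)
    (hcomm : ∀ i j, 1 ≤ i → i ≤ N → 1 ≤ j → j ≤ N → (i + 1 < j ∨ j + 1 < i) →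
      t i * t j = t j * t i) (i j : ℕ) (hi : 1 ≤ i) (hj : j ≤ N + 1) :
    qq (qword t) i j * qq (qword t) i j = 1 := by
  have h1 := aux_sq N t hinv hcomm (j-1) (by omega)
  have h2 := aux_sq N t hinv hcomm (j-i) (by omega)
  unfold qq
  generalize qword t (j-1) = x at *
  generalize qword t (j-i) = y at *
  calc x * y * x * (x * y * x) = x * (y * (x * x) * y) * x := by simp only [mul_assoc]
    _ = 1 := by rw [h1, mul_one, h2, mul_one, h1]

theorem aux_A (hinv : ∀ i, 1 ≤ i → i ≤ N → t i * t i = 1)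
    (hcomm : ∀ i j, 1 ≤ i → i ≤ N → 1 ≤ j → j ≤ N → (i + 1 < j ∨ j + 1 < i) →
      t i * t j = t j * t i) (a b j : ℕ) (ha : 1 ≤ a) (hb : 1 ≤ b) (hbj : b ≤ j) (hj : j ≤ N) :
    dword t j * qq (qword t) (a+1) (b+1) = qq (qword t) a b * dword t j := by
  induction j, hbj using Nat.le_induction with
  | base =>
    obtain ⟨c, rfl⟩ : ∃ c, b = c + 1 := ⟨b-1, by omega⟩
    have h := aux_dq N t hinv hcomm c hj
    have e2 : qword t (c+1) = qword t c * dword t (c+1) := rfl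
    have e3 : c + 1 + 1 - (a+1) = c + 1 - a := by omega
    simp only [qq, Nat.add_sub_cancel, e3]
    calc _ = (dword t (c+1) * qword t (c+1)) * qword t (c+1-a) * qword t (c+1) := by
          simp only [mul_assoc]
      _ = _ := by rw [h, e2]; simp only [mul_assoc]
  | succ j hbj ih =>
    have hc : Commute (qq (qword t) a b) (t (j+1)) := aux_qq t _ a b ha fun i h1 h2 =>
      hcomm i (j+1) h1 (by omega) (by omega) (by omega) (by omega)
    have e1 : dword t (j+1) = t (j+1) * dword t j := rfl
    rw [e1, mul_assoc, ih (by omega), ← mul_assoc, ← hc.eq, mul_assoc]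

theorem aux_B (hinv : ∀ i, 1 ≤ i → i ≤ N → t i * t i = 1)
    (hcomm : ∀ i j, 1 ≤ i → i ≤ N → 1 ≤ j → j ≤ N → (i + 1 < j ∨ j + 1 < i) →
      t i * t j = t j * t i) (k l j : ℕ) (hk : 1 ≤ k) (hkl : k < l) (hlj : l ≤ j)
      (hj : j ≤ N + 1) :
    qword t (j-1) * qq (qword t) k l = qq (qword t) (1+j-l) (1+j-k) * qword t (j-1) := by
  induction j, hlj using Nat.le_induction with
  | base =>
    have h1 := aux_sq N t hinv hcomm (l-1) (by omega)
    have h2 := aux_sq N t hinv hcomm (l-k) (by omega)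
    have e1 : 1 + l - l = 1 := by omega
    have e2 : 1 + l - k - 1 = l - k := by omega
    simp only [qq, e1, e2]
    rw [h2, one_mul, ← mul_assoc, ← mul_assoc, h1, one_mul]
  | succ j hlj ih =>
    have ih := ih (by omega)
    obtain ⟨c, rfl⟩ : ∃ c, j = c + 1 := ⟨j-1, by omega⟩
    have h := aux_dq N t hinv hcomm c (by omega)
    have hA := aux_A N t hinv hcomm (1+(c+1)-l) (1+(c+1)-k) (c+1) (by omega) (by omega) (by omega)
      (by omega)
    have e1 : 1 + (c+1+1) - l = 1+(c+1)-l+1 := by omega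
    have e2 : 1 + (c+1+1) - k = 1+(c+1)-k+1 := by omega
    rw [e1, e2]
    simp only [Nat.add_sub_cancel] at ih ⊢
    apply mul_left_cancel (a := dword t (c+1))
    rw [← mul_assoc, h, ih, ← mul_assoc, hA, mul_assoc, h]

end

/-- Chmutov--Glick--Pylyavskyy, one direction: in a group generated by
involutions `t_1, …, t_{n-1}` satisfying `t_i t_j = t_j t_i` for `|i-j| > 1` and
`(t_i q_{j,k})² = 1` for `i+1 < j < k ≤ n`, the elements
`q_{i,j} = q_{j-1} q_{j-i} q_{j-1}` satisfy the cactus relations. -/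
theorem bk_relations_imply_cactus_relations {G : Type*} [Group G] (n : ℕ) (t : ℕ → G)
    (hgen : Subgroup.closure {g : G | ∃ i, 1 ≤ i ∧ i ≤ n - 1 ∧ g = t i} = ⊤)
    (hinv : ∀ i, 1 ≤ i → i ≤ n - 1 → t i * t i = 1)
    (hcomm : ∀ i j, 1 ≤ i → i ≤ n - 1 → 1 ≤ j → j ≤ n - 1 → (i + 1 < j ∨ j + 1 < i) →
      t i * t j = t j * t i)
    (hq : ∀ i j k, 1 ≤ i → i + 1 < j → j < k → k ≤ n →
      (t i * qq (qword t) j k) * (t i * qq (qword t) j k) = 1) :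
    (∀ i j, 1 ≤ i → i < j → j ≤ n → qq (qword t) i j * qq (qword t) i j = 1) ∧
    (∀ i j k l, 1 ≤ i → i ≤ k → k < l → l ≤ j → i < j → j ≤ n →
      qq (qword t) i j * qq (qword t) k l * qq (qword t) i j =
        qq (qword t) (i + j - l) (i + j - k)) ∧
    (∀ i j k l, 1 ≤ i → i < j → j < k → k < l → l ≤ n →
      qq (qword t) i j * qq (qword t) k l = qq (qword t) k l * qq (qword t) i j) := by
  refine ⟨fun i j hi hij hj => aux_qqsq (n-1) t hinv hcomm i j hi (by omega), ?_, ?_⟩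
  · intro i j k l hi hik hkl hlj hij hj
    have s1 := aux_qqsq (n-1) t hinv hcomm i j hi (by omega)
    have b1 := aux_B (n-1) t hinv hcomm k l j (by omega) hkl hlj (by omega)
    have b2 := aux_B (n-1) t hinv hcomm (1+j-l) (1+j-k) (j-i+1) (by omega) (by omega) (by omega)
      (by omega)
    have b3 := aux_B (n-1) t hinv hcomm (1+(j-i+1)-(1+j-k)) (1+(j-i+1)-(1+j-l)) j (by omega)
      (by omega) (by omega) (by omega)
    have e1 : 1+j-(1+(j-i+1)-(1+j-l)) = i+j-l := by omega
    have e2 : 1+j-(1+(j-i+1)-(1+j-k)) = i+j-k := by omega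
    rw [e1, e2] at b3
    rw [Nat.add_sub_cancel] at b2
    have key : qq (qword t) i j * qq (qword t) k l =
        qq (qword t) (i+j-l) (i+j-k) * qq (qword t) i j := by
      have e : qq (qword t) i j = qword t (j-1) * qword t (j-i) * qword t (j-1) := rfl
      rw [e, mul_assoc, b1, mul_assoc, ← mul_assoc (qword t (j-i)), b2, ← mul_assoc,
        ← mul_assoc, b3]
      simp only [mul_assoc]
    rw [key, mul_assoc, s1, mul_one]
  · intro i j k l hi hij hjk hkl hl
    refine aux_qq t _ i j hi fun m h1 h2 => ?_
    have a1 := hq m k l h1 (by omega) hkl hl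
    have a2 := hinv m h1 (by omega)
    have a3 := aux_qqsq (n-1) t hinv hcomm k l (by omega) (by omega)
    have a4 := eq_inv_of_mul_eq_one_left a1
    rw [mul_inv_rev, ← eq_inv_of_mul_eq_one_left a2, ← eq_inv_of_mul_eq_one_left a3] at a4
    exact a4
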